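/- arXiv:2212.13112 — 2 statements merged into one kernel-verified Lean document; each statement's English description precedes it below -/
import Mathlib

section
/- Let n and m be nonnegative integers with m ≤ 2^n, and set f(n,m) = √(2^{n+2}·m) − m. Then Φ(n,m) ≥ f(n,m), with equality whenever f(n,m) is an integer, and Φ(n,m) ≤ f(n,m) + √(2^n). -/
open Finset

/-- The ground set `[n] = {1, …, n}`. -/
def groundSet (n : ℕ) : Finset ℕ := Finset.Icc 1 n

/-- The up-closure `𝓕↑` of a family `F` with respect to ground set `X`. -/
def upClo (X : Finset ℕ) (F : Finset (Finset ℕ)) : Finset (Finset ℕ) :=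
  X.powerset.filter (fun S => ∃ A ∈ F, A ⊆ S)

/-- The down-closure `𝓕↓` of a family `F` with respect to ground set `X`. -/
def downClo (X : Finset ℕ) (F : Finset (Finset ℕ)) : Finset (Finset ℕ) :=
  X.powerset.filter (fun S => ∃ A ∈ F, S ⊆ A)

/-- `𝓕↕ = 𝓕↑ ∪ 𝓕↓` with respect to ground set `X`. -/
def udClo (X : Finset ℕ) (F : Finset (Finset ℕ)) : Finset (Finset ℕ) :=
  upClo X F ∪ downClo X F

/-- `Φ(n,m)`: the minimum of `|𝓕↕|` over families `𝓕 ⊆ 2^[n]` with `|𝓕| = m`,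
closures taken w.r.t. the ground set `[n]`. -/
noncomputable def Phi (n m : ℕ) : ℕ :=
  sInf {k | ∃ F : Finset (Finset ℕ),
    F ⊆ (groundSet n).powerset ∧ F.card = m ∧ (udClo (groundSet n) F).card = k}

theorem isLowerSet_downClo (X : Finset ℕ) (F : Finset (Finset ℕ)) :
    IsLowerSet (downClo X F : Set (Finset ℕ)) := by
  intro S T hTS hS
  simp only [downClo, coe_filter, mem_powerset, Set.mem_ofPred_eq] at hS ⊢
  obtain ⟨hSX, A, hA, hSA⟩ := hS
  exact ⟨hTS.trans hSX, A, hA, hTS.trans hSA⟩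

theorem isLowerSet_powerset_sdiff_upClo (X : Finset ℕ) (F : Finset (Finset ℕ)) :
    IsLowerSet (↑(X.powerset \ upClo X F) : Set (Finset ℕ)) := by
  intro S T hTS hS
  simp only [upClo, mem_coe, mem_sdiff, mem_filter, mem_powerset, not_and, not_exists] at hS ⊢
  exact ⟨hTS.trans hS.1, fun _ A hA hAT => hS.2 hS.1 A hA (hAT.trans hTS)⟩

/-- Kleitman's correlation inequality for an up-closure and a down-closure. -/
theorem two_pow_mul_card_inter_le (X : Finset ℕ) (F : Finset (Finset ℕ)) :
    2 ^ #X * #(upClo X F ∩ downClo X F) ≤ #(upClo X F) * #(downClo X F) := by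
  have hU : upClo X F ⊆ X.powerset := filter_subset _ _
  have hD : downClo X F ⊆ X.powerset := filter_subset _ _
  have key := (isLowerSet_downClo X F).le_card_inter_finset'
    (isLowerSet_powerset_sdiff_upClo X F)
    (fun t ht => mem_powerset.1 (hD ht)) (fun t ht => mem_powerset.1 (mem_sdiff.1 ht).1)
  have hinter : downClo X F ∩ (X.powerset \ upClo X F) = downClo X F \ upClo X F := by
    ext S
    have := @hD S
    simp only [mem_inter, mem_sdiff]
    tauto
  rw [hinter] at key
  have h1 := card_sdiff_add_card_eq_card hU
  have h2 := card_sdiff_add_card_inter (downClo X F) (upClo X F)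
  rw [card_powerset] at h1
  rw [inter_comm] at h2
  rw [← h1] at key ⊢
  nlinarith

theorem subset_upClo_inter_downClo {X : Finset ℕ} {F : Finset (Finset ℕ)}
    (hF : F ⊆ X.powerset) : F ⊆ upClo X F ∩ downClo X F := fun S hS =>
  mem_inter.2 ⟨mem_filter.2 ⟨hF hS, S, hS, Subset.rfl⟩, mem_filter.2 ⟨hF hS, S, hS, Subset.rfl⟩⟩

theorem two_pow_mul_card_le_card_udClo_add_sq {X : Finset ℕ} {F : Finset (Finset ℕ)}
    (hF : F ⊆ X.powerset) : 2 ^ (#X + 2) * #F ≤ (#(udClo X F) + #F) ^ 2 := by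
  have hsub : udClo X F ⊆ X.powerset :=
    union_subset (filter_subset _ _) (filter_subset _ _)
  have hy := card_le_card hsub
  rw [card_powerset] at hy
  have ht := card_le_card (subset_upClo_inter_downClo hF)
  have hty : #(upClo X F ∩ downClo X F) ≤ #(udClo X F) :=
    card_le_card (inter_subset_left.trans subset_union_left)
  have hsum := card_union_add_card_inter (upClo X F) (downClo X F)
  have key := two_pow_mul_card_inter_le X F
  rw [pow_add]
  change #(udClo X F) + _ = _ at hsum
  generalize 2 ^ #X = N at *
  generalize #(udClo X F) = y at *
  generalize #(upClo X F ∩ downClo X F) = t at *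
  generalize #(upClo X F) = u at *
  generalize #(downClo X F) = d at *
  generalize #F = m at *
  zify at *
  have h1 : 4 * N * t ≤ (y + t : ℤ) ^ 2 := by
    rw [hsum]; nlinarith [sq_nonneg (u - d : ℤ)]
  nlinarith [mul_nonneg (sub_nonneg.2 ht) (by linarith : (0 : ℤ) ≤ 4 * N - 2 * y - m - t)]

theorem exists_card_isLowerSet (B : Finset ℕ) {d : ℕ} (hd : d ≤ 2 ^ #B) :
    ∃ D ⊆ B.powerset, #D = d ∧ IsLowerSet (D : Set (Finset ℕ)) := by
  induction hd using Nat.decreasingInduction with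
  | self =>
    refine ⟨B.powerset, Subset.rfl, card_powerset B, fun S T hTS hS => ?_⟩
    simp only [mem_coe, mem_powerset] at hS ⊢
    exact hTS.trans hS
  | of_succ d _ ih =>
    obtain ⟨D, hDB, hD, hlow⟩ := ih
    obtain ⟨M, hM⟩ := D.exists_maximal (card_pos.1 (by omega))
    refine ⟨D.erase M, (erase_subset _ _).trans hDB, by rw [card_erase_of_mem hM.1, hD]; rfl, ?_⟩
    intro S T hTS hS
    simp only [mem_coe, mem_erase] at hS ⊢
    refine ⟨fun h => hS.1 ?_, hlow hTS hS.2⟩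
    subst h
    exact (hM.2 hS.2 hTS).antisymm hTS

theorem exists_card_up_closed (A : Finset ℕ) {u : ℕ} (hu : u ≤ 2 ^ #A) :
    ∃ U ⊆ A.powerset, #U = u ∧ ∀ S ∈ U, ∀ T ⊆ A, S ⊆ T → T ∈ U := by
  obtain ⟨D, hDA, hD, hlow⟩ := exists_card_isLowerSet A (d := 2 ^ #A - u) (by omega)
  refine ⟨A.powerset \ D, sdiff_subset, ?_, fun S hS T hT hST => ?_⟩
  · rw [card_sdiff_of_subset hDA, card_powerset, hD]; omega
  · rw [mem_sdiff] at hS ⊢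
    exact ⟨mem_powerset.2 hT, fun h => hS.2 (hlow hST h)⟩

theorem card_filter_inter_mem {A B : Finset ℕ} (hAB : Disjoint A B)
    {P Q : Finset (Finset ℕ)} (hP : P ⊆ A.powerset) (hQ : Q ⊆ B.powerset) :
    #((A ∪ B).powerset.filter fun S => S ∩ A ∈ P ∧ S ∩ B ∈ Q) = #P * #Q := by
  rw [← card_product]
  refine card_nbij' (fun S => (S ∩ A, S ∩ B)) (fun p => p.1 ∪ p.2) ?_ ?_ ?_ ?_
  · intro S hS
    simpa using (mem_filter.1 hS).2
  · rintro ⟨S, T⟩ h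
    simp only [coe_product, Set.mem_prod, mem_coe] at h
    have hS := mem_powerset.1 (hP h.1)
    have hT := mem_powerset.1 (hQ h.2)
    simp only [mem_coe, mem_filter, mem_powerset]
    refine ⟨union_subset_union hS hT, ?_, ?_⟩
    · rw [union_inter_distrib_right, inter_eq_left.2 hS,
        disjoint_iff_inter_eq_empty.1 (hAB.symm.mono_left hT), union_empty]
      exact h.1
    · rw [union_inter_distrib_right, inter_eq_left.2 hT,
        disjoint_iff_inter_eq_empty.1 (hAB.mono_left hS), empty_union]
      exact h.2
  · intro S hS
    have := mem_powerset.1 (mem_filter.1 hS).1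
    simp only [← inter_union_distrib_left, inter_eq_left.2 this]
  · rintro ⟨S, T⟩ h
    simp only [coe_product, Set.mem_prod, mem_coe] at h
    have hS := mem_powerset.1 (hP h.1)
    have hT := mem_powerset.1 (hQ h.2)
    simp only [union_inter_distrib_right, inter_eq_left.2 hS, inter_eq_left.2 hT,
      disjoint_iff_inter_eq_empty.1 (hAB.symm.mono_left hT),
      disjoint_iff_inter_eq_empty.1 (hAB.mono_left hS), union_empty, empty_union]

/-- An up-closed and a down-closed family depending on disjoint sets of coordinates give a
family with small `udClo`. -/
theorem exists_card_udClo_add_le {A B : Finset ℕ} (hAB : Disjoint A B) {u d m : ℕ}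
    (hu : u ≤ 2 ^ #A) (hd : d ≤ 2 ^ #B) (hm : m ≤ u * d) :
    ∃ F ⊆ (A ∪ B).powerset, #F = m ∧
      #(udClo (A ∪ B) F) + m ≤ u * 2 ^ #B + 2 ^ #A * d := by
  obtain ⟨U, hUA, rfl, hup⟩ := exists_card_up_closed A hu
  obtain ⟨D, hDB, rfl, hlow⟩ := exists_card_isLowerSet B hd
  set U' := (A ∪ B).powerset.filter fun S => S ∩ A ∈ U ∧ S ∩ B ∈ B.powerset with hU'
  set D' := (A ∪ B).powerset.filter fun S => S ∩ A ∈ A.powerset ∧ S ∩ B ∈ D with hD'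
  have hinter : U' ∩ D' = (A ∪ B).powerset.filter fun S => S ∩ A ∈ U ∧ S ∩ B ∈ D := by
    ext S
    simp only [hU', hD', mem_inter, mem_filter, mem_powerset, inter_subset_right]
    tauto
  have hcardI : #(U' ∩ D') = #U * #D := by rw [hinter, card_filter_inter_mem hAB hUA hDB]
  have hcardU : #U' = #U * 2 ^ #B := by
    rw [hU', card_filter_inter_mem hAB hUA Subset.rfl, card_powerset]
  have hcardD : #D' = 2 ^ #A * #D := by
    rw [hD', card_filter_inter_mem hAB Subset.rfl hDB, card_powerset]
  obtain ⟨F, hF, rfl⟩ := exists_subset_card_eq (hm.trans_eq hcardI.symm)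
  refine ⟨F, hF.trans (inter_subset_left.trans (filter_subset _ _)), rfl, ?_⟩
  have hsub : udClo (A ∪ B) F ⊆ U' ∪ D' := by
    refine union_subset_union (fun S hS => ?_) (fun S hS => ?_)
    · obtain ⟨hSX, T, hT, hTS⟩ := mem_filter.1 hS
      have hTU := (mem_filter.1 (mem_inter.1 (hF hT)).1).2.1
      exact mem_filter.2 ⟨hSX, hup _ hTU _ inter_subset_right (inter_subset_inter_right hTS),
        mem_powerset.2 inter_subset_right⟩
    · obtain ⟨hSX, T, hT, hST⟩ := mem_filter.1 hS
      have hTD := (mem_filter.1 (mem_inter.1 (hF hT)).2).2.2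
      exact mem_filter.2 ⟨hSX, mem_powerset.2 inter_subset_right,
        hlow (inter_subset_inter_right hST) hTD⟩
  have h1 := card_le_card hsub
  have h2 := card_union_add_card_inter U' D'
  omega

theorem card_groundSet (n : ℕ) : #(groundSet n) = n := by simp [groundSet]

theorem Phi_add_le {a b u d m : ℕ} (hu : u ≤ 2 ^ a) (hd : d ≤ 2 ^ b) (hm : m ≤ u * d) :
    Phi (a + b) m + m ≤ u * 2 ^ b + 2 ^ a * d := by
  have hA : #(Icc 1 a) = a := by simp
  have hB : #(Icc (a + 1) (a + b)) = b := by simp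
  have hX : Icc 1 a ∪ Icc (a + 1) (a + b) = groundSet (a + b) := by
    ext i; simp only [groundSet, mem_union, mem_Icc]; omega
  have hAB : Disjoint (Icc 1 a) (Icc (a + 1) (a + b)) :=
    disjoint_left.2 fun i hi hi' => by simp only [mem_Icc] at hi hi'; omega
  obtain ⟨F, hF, hFm, hle⟩ :=
    exists_card_udClo_add_le hAB (hu.trans_eq (by rw [hA])) (hd.trans_eq (by rw [hB])) hm
  rw [hA, hB, hX] at hle
  rw [hX] at hF
  have hPhi : Phi (a + b) m ≤ #(udClo (groundSet (a + b)) F) := Nat.sInf_le ⟨F, hF, hFm, rfl⟩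
  exact (Nat.add_le_add_right hPhi m).trans hle

theorem two_pow_mul_le_Phi_add_sq {n m : ℕ} (hm : m ≤ 2 ^ n) :
    2 ^ (n + 2) * m ≤ (Phi n m + m) ^ 2 := by
  have hne : {k | ∃ F : Finset (Finset ℕ),
      F ⊆ (groundSet n).powerset ∧ F.card = m ∧ (udClo (groundSet n) F).card = k}.Nonempty := by
    obtain ⟨F, hF, hFm⟩ := exists_subset_card_eq
      (hm.trans_eq (by rw [card_powerset, card_groundSet] : 2 ^ n = #(groundSet n).powerset))
    exact ⟨_, F, hF, hFm, rfl⟩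
  obtain ⟨F, hF, hFm, hk⟩ := Nat.sInf_mem hne
  have := two_pow_mul_card_le_card_udClo_add_sq hF
  rw [hFm, hk, card_groundSet] at this
  exact this

theorem Phi_two_mul_add_le {k m q : ℕ} (hq : 4 * m ≤ q ^ 2) (hqk : q ≤ 2 * 2 ^ k) :
    Phi (k + k) m + m ≤ 2 ^ k * q := by
  obtain ⟨s, rfl | rfl⟩ := Nat.even_or_odd' q
  · have := Phi_add_le (a := k) (b := k) (u := s) (d := s) (m := m) (by omega) (by omega)
      (by nlinarith)
    linarith
  · have := Phi_add_le (a := k) (b := k) (u := s) (d := s + 1) (m := m) (by omega) (by omega)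
      (by ring_nf at hq ⊢; omega)
    linarith

theorem Phi_two_mul_add_one_add_le {k m q : ℕ} (hq : 8 * m ≤ q ^ 2) (hqk : q ≤ 4 * 2 ^ k) :
    Phi (k + (k + 1)) m + m ≤ 2 ^ k * q := by
  obtain ⟨u, d, rfl, hu, hd, hm⟩ : ∃ u d, q = 2 * u + d ∧ u ≤ 2 ^ k ∧ d ≤ 2 ^ (k + 1) ∧
      m ≤ u * d := by
    obtain ⟨s, r, hr, rfl⟩ : ∃ s r, r < 4 ∧ q = 4 * s + r :=
      ⟨q / 4, q % 4, Nat.mod_lt _ (by omega), by omega⟩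
    rw [pow_succ]
    interval_cases r
    · exact ⟨s, 2 * s, by omega, by omega, by omega, by ring_nf at hq ⊢; omega⟩
    · exact ⟨s, 2 * s + 1, by omega, by omega, by omega, by ring_nf at hq ⊢; omega⟩
    · exact ⟨s, 2 * s + 2, by omega, by omega, by omega, by ring_nf at hq ⊢; omega⟩
    · exact ⟨s + 1, 2 * s + 1, by omega, by omega, by omega, by ring_nf at hq ⊢; omega⟩
  have := Phi_add_le hu hd hm
  rw [pow_succ] at this
  linarith

theorem Phi_bounds_of_forall {n m c K M : ℕ} (hm : m ≤ 2 ^ n) (hK : 0 < K)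
    (hKc : K ^ 2 * c = 2 ^ (n + 2)) (hKn : K ^ 2 ≤ 2 ^ n) (hM : M ^ 2 = c * 2 ^ n)
    (h : ∀ q, c * m ≤ q ^ 2 → q ≤ M → Phi n m + m ≤ K * q) :
    Real.sqrt (2 ^ (n + 2) * m) - m ≤ (Phi n m : ℝ) ∧
    ((∃ z : ℤ, (z : ℝ) = Real.sqrt (2 ^ (n + 2) * m) - m) →
      (Phi n m : ℝ) = Real.sqrt (2 ^ (n + 2) * m) - m) ∧
    (Phi n m : ℝ) ≤ Real.sqrt (2 ^ (n + 2) * m) - m + Real.sqrt (2 ^ n) := by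
  have hlower : Real.sqrt (2 ^ (n + 2) * m) - m ≤ (Phi n m : ℝ) := by
    rw [sub_le_iff_le_add]
    exact Real.sqrt_le_iff.2 ⟨by positivity, by exact_mod_cast two_pow_mul_le_Phi_add_sq hm⟩
  have hcm : c * m ≤ M ^ 2 := by rw [hM]; gcongr
  have hsqrt : Real.sqrt (2 ^ (n + 2) * m) = K * Real.sqrt (c * m : ℕ) := by
    have h2 : (2 ^ (n + 2) * m : ℝ) = (K : ℝ) ^ 2 * (c * m : ℕ) := by
      have : ((K ^ 2 * c : ℕ) : ℝ) = (2 ^ (n + 2) : ℕ) := by rw [hKc]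
      push_cast at this ⊢
      rw [← this]; ring
    rw [h2, Real.sqrt_mul (by positivity), Real.sqrt_sq (by positivity)]
  refine ⟨hlower, ?_, ?_⟩
  · rintro ⟨z, hz⟩
    refine le_antisymm ?_ hlower
    obtain ⟨w, hw⟩ : ∃ w : ℕ, (w : ℝ) = Real.sqrt (2 ^ (n + 2) * m) := by
      have hzm : ((z + m : ℤ) : ℝ) = Real.sqrt (2 ^ (n + 2) * m) := by push_cast; linarith
      have h0 : 0 ≤ z + m := by
        have := Real.sqrt_nonneg (2 ^ (n + 2) * m)
        rw [← hzm] at this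
        exact_mod_cast this
      lift z + m to ℕ using h0 with w
      exact ⟨w, by exact_mod_cast hzm⟩
    have hw2 : w ^ 2 = K ^ 2 * (c * m) := by
      have : (w : ℝ) ^ 2 = (K : ℝ) ^ 2 * (c * m : ℕ) := by
        rw [hw, hsqrt, mul_pow, Real.sq_sqrt (by positivity)]
      exact_mod_cast this
    obtain ⟨q, rfl⟩ := (Nat.pow_dvd_pow_iff two_ne_zero).1 (Dvd.intro _ hw2.symm)
    have hq : q ^ 2 = c * m := by
      rw [mul_pow] at hw2
      exact Nat.eq_of_mul_eq_mul_left (by positivity) hw2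
    have := h q hq.ge (by rw [← hq] at hcm; exact (Nat.pow_le_pow_iff_left two_ne_zero).1 hcm)
    rw [← hw, le_sub_iff_add_le]
    exact_mod_cast this
  · have hq1 : Real.sqrt (c * m : ℕ) ≤ ⌈Real.sqrt (c * m : ℕ)⌉₊ := Nat.le_ceil _
    have hq2 := (Nat.ceil_lt_add_one (Real.sqrt_nonneg (c * m : ℕ))).le
    have hqM : ⌈Real.sqrt (c * m : ℕ)⌉₊ ≤ M :=
      Nat.ceil_le.2 (Real.sqrt_le_iff.2 ⟨by positivity, by exact_mod_cast hcm⟩)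
    have hle := h _ (by exact_mod_cast (Real.sqrt_le_left (by positivity)).1 hq1) hqM
    have hle' : (Phi n m : ℝ) + m ≤ K * ⌈Real.sqrt (c * m : ℕ)⌉₊ := by exact_mod_cast hle
    have hKs : (K : ℝ) ≤ Real.sqrt (2 ^ n) := Real.le_sqrt_of_sq_le (by exact_mod_cast hKn)
    have := mul_le_mul_of_nonneg_left hq2 (Nat.cast_nonneg (α := ℝ) K)
    rw [hsqrt]
    linarith

/-- Corollary 2: `Φ(n,m) ≥ f(n,m)` where `f(n,m) = √(2^(n+2) m) - m`, with equality
whenever `f(n,m)` is an integer, and moreover `Φ(n,m) ≤ f(n,m) + √(2^n)`. -/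
theorem stmt1 (n m : ℕ) (hm : m ≤ 2 ^ n) :
    Real.sqrt (2 ^ (n + 2) * m) - m ≤ (Phi n m : ℝ) ∧
    ((∃ z : ℤ, (z : ℝ) = Real.sqrt (2 ^ (n + 2) * m) - m) →
      (Phi n m : ℝ) = Real.sqrt (2 ^ (n + 2) * m) - m) ∧
    (Phi n m : ℝ) ≤ Real.sqrt (2 ^ (n + 2) * m) - m + Real.sqrt (2 ^ n) := by
  obtain ⟨k, rfl | rfl⟩ := Nat.even_or_odd' n
  · rw [two_mul] at *
    exact Phi_bounds_of_forall (c := 4) (K := 2 ^ k) (M := 2 * 2 ^ k) hm (by positivity)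
      (by ring) (by rw [← pow_mul, mul_two]) (by ring) fun q => Phi_two_mul_add_le
  · rw [two_mul, add_assoc] at *
    exact Phi_bounds_of_forall (c := 8) (K := 2 ^ k) (M := 4 * 2 ^ k) hm (by positivity)
      (by ring) (by rw [← pow_mul]; exact Nat.pow_le_pow_right two_pos (by omega)) (by ring)
      fun q => Phi_two_mul_add_one_add_le
end

section
/- Let m and n be nonnegative integers such that m ≤ 2^n. Then Φ(n,m) = 2^n − s, where s is the greatest element of {0,…,2^n} such that Φ(n,s) ≤ 2^n − m. -/
open Finset

theorem mem_udClo {X : Finset ℕ} {F : Finset (Finset ℕ)} {S : Finset ℕ} :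
    S ∈ udClo X F ↔ S ⊆ X ∧ ∃ A ∈ F, A ⊆ S ∨ S ⊆ A := by
  simp only [udClo, upClo, downClo, mem_union, mem_filter, mem_powerset]
  grind

theorem udClo_subset_powerset (X : Finset ℕ) (F : Finset (Finset ℕ)) :
    udClo X F ⊆ X.powerset := fun _ hS => mem_powerset.2 (mem_udClo.1 hS).1

theorem card_powerset_groundSet (n : ℕ) : #(groundSet n).powerset = 2 ^ n := by
  simp [groundSet]

theorem Phi_le_card_udClo {n : ℕ} {F : Finset (Finset ℕ)} (hF : F ⊆ (groundSet n).powerset) :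
    Phi n #F ≤ #(udClo (groundSet n) F) :=
  Nat.sInf_le ⟨F, hF, rfl, rfl⟩

theorem exists_card_udClo_eq_Phi {n m : ℕ} (hm : m ≤ 2 ^ n) :
    ∃ F ⊆ (groundSet n).powerset, #F = m ∧ #(udClo (groundSet n) F) = Phi n m := by
  have hne : {k | ∃ F : Finset (Finset ℕ),
      F ⊆ (groundSet n).powerset ∧ #F = m ∧ #(udClo (groundSet n) F) = k}.Nonempty := by
    obtain ⟨F, hF, hc⟩ := exists_subset_card_eq (hm.trans_eq (card_powerset_groundSet n).symm)
    exact ⟨_, F, hF, hc, rfl⟩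
  exact Nat.sInf_mem hne

/-- A family avoiding `𝓕↕` has its own closure avoiding `𝓕`. -/
theorem udClo_subset_sdiff {X : Finset ℕ} {F G : Finset (Finset ℕ)}
    (hG : G ⊆ X.powerset \ udClo X F) : udClo X G ⊆ X.powerset \ F := by
  intro S hS
  obtain ⟨hSX, A, hA, h⟩ := mem_udClo.1 hS
  obtain ⟨hAX, hAF⟩ := mem_sdiff.1 (hG hA)
  exact mem_sdiff.2 ⟨mem_powerset.2 hSX, fun hSF =>
    hAF (mem_udClo.2 ⟨mem_powerset.1 hAX, S, hSF, h.symm⟩)⟩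

theorem Phi_le_of_le_sub_Phi {n m t : ℕ} (hm : m ≤ 2 ^ n) (ht : t ≤ 2 ^ n - Phi n m) :
    Phi n t ≤ 2 ^ n - m := by
  obtain ⟨F, hF, hFm, hFc⟩ := exists_card_udClo_eq_Phi hm
  have hcard : #((groundSet n).powerset \ udClo (groundSet n) F) = 2 ^ n - Phi n m := by
    rw [card_sdiff_of_subset (udClo_subset_powerset _ _), card_powerset_groundSet, hFc]
  obtain ⟨G, hG, rfl⟩ := exists_subset_card_eq (ht.trans_eq hcard.symm)
  calc Phi n #G ≤ #(udClo (groundSet n) G) := Phi_le_card_udClo (hG.trans sdiff_subset)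
    _ ≤ #((groundSet n).powerset \ F) := card_le_card (udClo_subset_sdiff hG)
    _ = 2 ^ n - m := by rw [card_sdiff_of_subset hF, card_powerset_groundSet, hFm]

/-- Lemma 5 (self-conjugacy): `Φ(n,m) = 2^n - s` where `s` is the greatest element of
`{0, …, 2^n}` such that `Φ(n,s) ≤ 2^n - m`. -/
theorem stmt4 (n m : ℕ) (hm : m ≤ 2 ^ n) (s : ℕ)
    (hs : IsGreatest {t : ℕ | t ≤ 2 ^ n ∧ Phi n t ≤ 2 ^ n - m} s) :
    Phi n m = 2 ^ n - s := by
  obtain ⟨⟨hs1, hs2⟩, hmax⟩ := hs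
  have hle : Phi n m ≤ 2 ^ n - s := Phi_le_of_le_sub_Phi hs1 (by omega)
  have hge : 2 ^ n - Phi n m ≤ s := hmax ⟨Nat.sub_le _ _, Phi_le_of_le_sub_Phi hm le_rfl⟩
  omega
end
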